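/- Let S = { p^i : i ≥ 0 } for some integer p ≥ 2, and let F** = (S, R**, M**) be the FVR defined by Procedure E2 with target set S. Then for every FVR F = (S, R, M) with this target set that is universal in P_k, every n, and every P ∈ P_k, L_P^n(M) ≤ L_P^n(M**). -/

import Mathlib

open Finset

/-- Symbol at (0-indexed) integer position `j` of `x : Fin n → A`, where negative
positions `-k, …, -1` are given by the fixed initial state `s0`. -/
def symAt {A : Type*} [Inhabited A] (k n : ℕ) (s0 : Fin k → A) (x : Fin n → A) (j : ℤ) : A :=
  if h : 0 ≤ j then
    (if h2 : j.toNat < n then x ⟨j.toNat, h2⟩ else default)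
  else
    (if h3 : (j + k).toNat < k then s0 ⟨(j + k).toNat, h3⟩ else default)

/-- The state (context of order `k`) preceding position `t` of `x`. -/
def ctx {A : Type*} [Inhabited A] (k n : ℕ) (s0 : Fin k → A) (x : Fin n → A)
    (t : Fin n) : Fin k → A :=
  fun i => symAt k n s0 x ((t : ℤ) - (k : ℤ) + (i : ℤ))

/-- Probability `P(x^n) = ∏_t p(x_t | x_{t-k}^{t-1})` of the sequence `x`. -/
def seqProb {A : Type*} [Inhabited A] (k n : ℕ) (s0 : Fin k → A)
    (p : (Fin k → A) → A → ℝ) (x : Fin n → A) : ℝ :=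
  ∏ t : Fin n, p (ctx k n s0 x t) (x t)

/-- `p` is a (strictly positive) `k`-th order Markov kernel. -/
def IsMarkov {A : Type*} [Fintype A] (k : ℕ) (p : (Fin k → A) → A → ℝ) : Prop :=
  (∀ s a, 0 < p s a) ∧ ∀ s, ∑ a : A, p s a = 1

/-- `n_{sa}(x)`: number of occurrences of symbol `a` in state `s`. -/
def transCount {A : Type*} [Inhabited A] [DecidableEq A] (k n : ℕ) (s0 : Fin k → A)
    (s : Fin k → A) (a : A) (x : Fin n → A) : ℕ :=
  (Finset.univ.filter (fun t : Fin n => ctx k n s0 x t = s ∧ x t = a)).card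

/-- The type class of `x` with respect to the class of `k`-th order processes. -/
def typeClass {A : Type*} [Fintype A] [Inhabited A] [DecidableEq A] (k n : ℕ)
    (s0 : Fin k → A) (x : Fin n → A) : Finset (Fin n → A) :=
  Finset.univ.filter (fun y => ∀ s a, transCount k n s0 s a y = transCount k n s0 s a x)

/-- The FVR `(S, Rf, Mf)` is perfect for the process `p`: conditioned on
`Mf(X^n) = M0` (whenever this event has positive probability), the output
`Rf(X^n)` is uniformly distributed on `{0, …, M0 - 1}`. -/
def PerfectFVR {A : Type*} [Fintype A] [Inhabited A] [DecidableEq A] (k n : ℕ)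
    (s0 : Fin k → A) (p : (Fin k → A) → A → ℝ) (S : Set ℕ)
    (Mf Rf : (Fin n → A) → ℕ) : Prop :=
  ∀ M0 ∈ S,
    (0 < ∑ x ∈ Finset.univ.filter (fun x : Fin n → A => Mf x = M0), seqProb k n s0 p x) →
    ∀ r < M0,
      (∑ x ∈ Finset.univ.filter (fun x : Fin n → A => Mf x = M0 ∧ Rf x = r),
          seqProb k n s0 p x)
        = (∑ x ∈ Finset.univ.filter (fun x : Fin n → A => Mf x = M0),
            seqProb k n s0 p x) / (M0 : ℝ)

/-- `g(M) = max { j ∈ S : j ≤ M }` (and `0` if no element of `S` is `≤ M`). -/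
noncomputable def gmax (S : Set ℕ) (M : ℕ) : ℕ :=
  @Nat.findGreatest (· ∈ S) (Classical.decPred _) M

/-- The greedy decomposition step of Procedure E2. -/
noncomputable def e2 (S : Set ℕ) : ℕ → ℕ → ℕ × ℕ
  | r, idx =>
    if h : 0 < gmax S r ∧ gmax S r ≤ idx then e2 S (r - gmax S r) (idx - gmax S r)
    else (gmax S r, idx)
  termination_by r idx => idx
  decreasing_by exact Nat.sub_lt (Nat.lt_of_lt_of_le h.1 h.2) h.1

/-- The state following `s` after emitting the symbol `a`. -/
def nextState {A : Type*} {k : ℕ} (s : Fin k → A) (a : A) : Fin k → A :=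
  fun i => if h : (i : ℕ) + 1 < k then s ⟨i + 1, h⟩ else a

section DeBruijn

variable {A : Type*} {k : ℕ}

lemma nextState_congr {s s' : Fin k → A} {a b : A} (h : nextState s a = nextState s' b) (c : A) :
    nextState s c = nextState s' c := by
  funext i
  have hi := congrFun h i
  unfold nextState at hi ⊢
  split_ifs at hi ⊢ <;> simp_all

lemma mem_of_nextState_closed {O : Set (Fin k → A)} (hO : ∀ s ∈ O, ∀ a, nextState s a ∈ O)
    {s : Fin k → A} (hs : s ∈ O) (u : Fin k → A) : u ∈ O := by
  have key : ∀ j ≤ k, ∃ v ∈ O, ∀ i m : Fin k, (i : ℕ) + j = k + m → v i = u m := by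
    intro j
    induction j with
    | zero => exact fun _ => ⟨s, hs, fun i m h => by omega⟩
    | succ j ih =>
      intro hj
      obtain ⟨v, hv, hvu⟩ := ih (by omega)
      refine ⟨nextState v (u ⟨j, hj⟩), hO v hv _, fun i m h => ?_⟩
      unfold nextState
      split_ifs with hi
      · exact hvu _ _ (by simp only; omega)
      · congr 1
        ext
        simp only
        omega
  obtain ⟨v, hv, hvu⟩ := key k le_rfl
  have : v = u := funext fun i => hvu i i (by omega)
  exact this ▸ hv

lemma exists_perm_nextState [Finite A] [Inhabited A] :
    ∃ F : Equiv.Perm (Fin k → A), ∀ s, ∃ a, F s = nextState s a := by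
  let r : (Fin k → A) → (Fin k → A) :=
    fun s => nextState s (if h : 0 < k then s ⟨0, h⟩ else default)
  have hr : Function.Injective r := by
    intro s s' h
    funext i
    rcases Nat.eq_zero_or_pos (i : ℕ) with hi | hi
    · have hk : 0 < k := by omega
      have h1 := congrFun h ⟨k - 1, by omega⟩
      have h2 : ¬ (k - 1 + 1 < k) := by omega
      have h3 : i = ⟨0, hk⟩ := Fin.ext hi
      simpa [r, nextState, hk, h2, ← h3] using h1
    · have h1 := congrFun h ⟨i - 1, by omega⟩
      have h2 : (i : ℕ) - 1 + 1 = i := by omega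
      simpa [r, nextState, h2] using h1
  exact ⟨Equiv.ofBijective r (Finite.injective_iff_bijective.1 hr), fun s => ⟨_, rfl⟩⟩

lemma sameCycle_mul_swap {X : Type*} [Finite X] [DecidableEq X] {F : Equiv.Perm X} {s s' : X}
    (h : ¬ F.SameCycle s s') :
    (F * Equiv.swap s s').SameCycle s s' := by
  set G := F * Equiv.swap s s' with hG
  by_contra hn
  have key : ∀ i : ℕ, G.SameCycle s ((F ^ (i + 1)) s') := by
    intro i
    induction i with
    | zero =>
      have : (F ^ (0 + 1)) s' = G s := by simp [hG]
      rw [this]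
      exact (Equiv.Perm.sameCycle_apply_right).2 (Equiv.Perm.SameCycle.refl _ _)
    | succ i ih =>
      have h1 : (F ^ (i + 1)) s' ≠ s := fun e => h (by
        have : F.SameCycle s' s := ⟨(i + 1 : ℕ), by rw [zpow_natCast]; exact e⟩
        exact this.symm)
      have h2 : (F ^ (i + 1)) s' ≠ s' := fun e => hn (e ▸ ih)
      have h3 : (F ^ (i + 1 + 1)) s' = G ((F ^ (i + 1)) s') := by
        rw [pow_succ' F (i + 1)]
        simp [hG, Equiv.swap_apply_of_ne_of_ne h1 h2]
      rw [h3]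
      exact (Equiv.Perm.sameCycle_apply_right).2 ih
  have h0 := key (orderOf F - 1)
  rw [Nat.sub_add_cancel (orderOf_pos F), pow_orderOf_eq_one] at h0
  exact hn h0

lemma sameCycle_of_forall_apply {X : Type*} {F G : Equiv.Perm X}
    (h : ∀ x, G.SameCycle x (F x)) [Finite X] {x y : X} (hxy : F.SameCycle x y) :
    G.SameCycle x y := by
  obtain ⟨i, rfl⟩ := hxy.exists_nat_pow_eq
  induction i with
  | zero => exact Equiv.Perm.SameCycle.refl _ _
  | succ i ih =>
    rw [pow_succ', Equiv.Perm.mul_apply]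
    exact (ih ⟨i, by simp⟩).trans (h _)

/-- A de Bruijn cycle: the shift graph on `A ^ k` has a Hamiltonian cycle. -/
theorem exists_deBruijn_cycle [Finite A] [Inhabited A] :
    ∃ F : Equiv.Perm (Fin k → A), (∀ s, ∃ a, F s = nextState s a) ∧ ∀ x y, F.SameCycle x y := by
  classical
  have hne : {F : Equiv.Perm (Fin k → A) | ∀ s, ∃ a, F s = nextState s a}.Nonempty :=
    exists_perm_nextState
  obtain ⟨F, hF, hmax⟩ := Set.exists_max_image _
    (fun F : Equiv.Perm (Fin k → A) => {q : (Fin k → A) × (Fin k → A) | F.SameCycle q.1 q.2}.ncard)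
    (Set.toFinite _) hne
  refine ⟨F, hF, fun x y => ?_⟩
  by_contra hxy
  obtain ⟨s, hs, a, ha⟩ : ∃ s, F.SameCycle x s ∧ ∃ a, ¬ F.SameCycle x (nextState s a) := by
    by_contra! hcl
    exact hxy (mem_of_nextState_closed (O := {s | F.SameCycle x s}) hcl
      (Equiv.Perm.SameCycle.refl F x) y)
  obtain ⟨s', hs'⟩ := F.surjective (nextState s a)
  have hss : ¬ F.SameCycle s s' := fun h =>
    ha (hs' ▸ (Equiv.Perm.sameCycle_apply_right).2 (hs.trans h))
  set G := F * Equiv.swap s s' with hG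
  have hGss : G.SameCycle s s' := sameCycle_mul_swap hss
  have hGs : G s = F s' := by simp [hG]
  have hGs' : G s' = F s := by simp [hG]
  have hGF : ∀ z, z ≠ s → z ≠ s' → G z = F z := fun z h1 h2 => by
    simp [hG, Equiv.swap_apply_of_ne_of_ne h1 h2]
  have hGmem : ∀ z, ∃ b, G z = nextState z b := by
    intro z
    by_cases h1 : z = s
    · exact ⟨a, by rw [h1, hGs, hs']⟩
    by_cases h2 : z = s'
    · obtain ⟨c, hc⟩ := hF s
      obtain ⟨b, hb⟩ := hF s'
      exact ⟨c, by rw [h2, hGs', hc, nextState_congr (hs'.symm.trans hb) c]⟩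
    · rw [hGF z h1 h2]
      exact hF z
  have hstep : ∀ z, G.SameCycle z (F z) := by
    intro z
    by_cases h1 : z = s
    · rw [h1, ← hGs']
      exact (Equiv.Perm.sameCycle_apply_right).2 hGss
    by_cases h2 : z = s'
    · rw [h2, ← hGs]
      exact (Equiv.Perm.sameCycle_apply_right).2 hGss.symm
    · rw [← hGF z h1 h2]
      exact (Equiv.Perm.sameCycle_apply_right).2 (Equiv.Perm.SameCycle.refl _ _)
  have hlt : {q : (Fin k → A) × (Fin k → A) | F.SameCycle q.1 q.2}.ncard <
      {q : (Fin k → A) × (Fin k → A) | G.SameCycle q.1 q.2}.ncard := by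
    refine Set.ncard_lt_ncard ⟨fun q hq => sameCycle_of_forall_apply hstep hq, fun hsub => ?_⟩
      (Set.toFinite _)
    exact hss (hsub (a := (s, s')) hGss)
  exact absurd (hmax G hGmem) (not_le.2 hlt)

end DeBruijn

/-- A circulation of total value zero along a single cycle that is perturbed only by a unit
source and a unit sink vanishes. -/
lemma eq_zero_of_cyclic_flow {X : Type*} [Fintype X] [DecidableEq X] {F : Equiv.Perm X}
    (hF : ∀ x y, F.SameCycle x y) {d : X → ℤ} {g h : X}
    (hd : ∀ s, d (F s) + (if g = F s then 1 else 0) = d s + (if h = F s then 1 else 0))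
    (hsum : ∑ s, d s = 0) (s : X) : d s = 0 := by
  have upper : ∀ z, d z ≤ d h := by
    intro z
    obtain ⟨i, rfl⟩ := (hF h z).exists_nat_pow_eq
    induction i with
    | zero => simp
    | succ i ih =>
      rw [pow_succ', Equiv.Perm.mul_apply]
      have := hd ((F ^ i) h)
      by_cases hh : h = F ((F ^ i) h)
      · rw [← hh]
      · rw [if_neg hh] at this
        split_ifs at this <;> omega
  obtain ⟨b, hb⟩ := F.surjective h
  have lower : ∀ z, d b ≤ d z := by
    intro z
    obtain ⟨i, hi⟩ := (hF z b).exists_nat_pow_eq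
    induction i generalizing z with
    | zero =>
      have : z = b := by simpa using hi
      rw [this]
    | succ i ih =>
      by_cases hh : h = F z
      · have : b = z := F.injective (hb.trans hh)
        rw [this]
      · rw [pow_succ, Equiv.Perm.mul_apply] at hi
        have h1 := ih _ hi
        have h2 := hd z
        rw [if_neg hh] at h2
        split_ifs at h2 <;> omega
  have hbh := hd b
  rw [hb, if_pos rfl] at hbh
  rcases le_or_gt (d h) 0 with h0 | h0
  · exact (Finset.sum_eq_zero_iff_of_nonpos fun z _ => (upper z).trans h0).1 hsum s
      (Finset.mem_univ s)
  · refine (Finset.sum_eq_zero_iff_of_nonneg fun z _ => le_trans ?_ (lower z)).1 hsum s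
      (Finset.mem_univ s)
    split_ifs at hbh <;> omega

section Types

variable {A : Type*} [Inhabited A] {k n : ℕ} {s0 : Fin k → A}

/-- The state of `x` at time `t`, where `t = n` is allowed. -/
def stateAt (k n : ℕ) (s0 : Fin k → A) (x : Fin n → A) (t : ℕ) : Fin k → A :=
  fun i => symAt k n s0 x ((t : ℤ) - (k : ℤ) + (i : ℤ))

lemma stateAt_zero (x : Fin n → A) : stateAt k n s0 x 0 = s0 := by
  funext i
  have h1 : ¬ (0 ≤ ((0 : ℕ) : ℤ) - (k : ℤ) + (i : ℤ)) := by omega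
  have h2 : (((0 : ℕ) : ℤ) - (k : ℤ) + (i : ℤ) + k).toNat = i := by omega
  simp only [stateAt, symAt, dif_neg h1, h2, i.2, dif_pos, Fin.eta]

lemma stateAt_succ (x : Fin n → A) (t : Fin n) :
    stateAt k n s0 x (t + 1) = nextState (ctx k n s0 x t) (x t) := by
  funext i
  unfold stateAt nextState ctx
  split_ifs with h
  · congr 1
    push_cast
    ring
  · have h1 : (((t : ℕ) + 1 : ℕ) : ℤ) - (k : ℤ) + (i : ℤ) = (t : ℕ) := by omega
    rw [h1]
    simp [symAt]

variable [DecidableEq A]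

lemma transCount_eq_sum (s : Fin k → A) (a : A) (x : Fin n → A) :
    transCount k n s0 s a x = ∑ t : Fin n, if ctx k n s0 x t = s ∧ x t = a then 1 else 0 := by
  rw [transCount, Finset.card_filter]

variable [Fintype A]

lemma sum_transCount_out (x : Fin n → A) (u : Fin k → A) :
    ∑ a, transCount k n s0 u a x = ∑ t ∈ range n, if stateAt k n s0 x t = u then 1 else 0 := by
  simp_rw [transCount_eq_sum]
  rw [Finset.sum_comm, Finset.sum_range]
  refine Finset.sum_congr rfl fun t _ => ?_
  by_cases h : ctx k n s0 x t = u
  · have h' : stateAt k n s0 x t = u := h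
    simp [h, h']
  · have h' : ¬ stateAt k n s0 x t = u := h
    simp [h, h']

lemma sum_transCount_in (x : Fin n → A) (u : Fin k → A) :
    ∑ s, ∑ a, (if nextState s a = u then transCount k n s0 s a x else 0) =
      ∑ t ∈ range n, if stateAt k n s0 x (t + 1) = u then 1 else 0 := by
  have h : ∀ (s : Fin k → A) (a : A), (if nextState s a = u then transCount k n s0 s a x else 0) =
      ∑ t : Fin n, if ctx k n s0 x t = s then
        (if x t = a then (if nextState s a = u then 1 else 0) else 0) else 0 := by
    intro s a
    rw [transCount_eq_sum]
    split_ifs with hu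
    · simp [ite_and]
    · simp
  simp_rw [h]
  rw [Finset.sum_congr rfl fun s _ => Finset.sum_comm, Finset.sum_comm, Finset.sum_range]
  refine Finset.sum_congr rfl fun t _ => ?_
  rw [stateAt_succ]
  rw [Finset.sum_eq_single (ctx k n s0 x t), Finset.sum_eq_single (x t)]
  · simp
  · intro b _ hb
    simp [hb.symm]
  · simp
  · intro b _ hb
    simp [hb.symm]
  · simp

lemma transCount_flow (x : Fin n → A) (u : Fin k → A) :
    ∑ a, transCount k n s0 u a x + (if stateAt k n s0 x n = u then 1 else 0) =
      ∑ s, ∑ a, (if nextState s a = u then transCount k n s0 s a x else 0) +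
        (if s0 = u then 1 else 0) := by
  rw [sum_transCount_out, sum_transCount_in, ← Finset.sum_range_succ, Finset.sum_range_succ',
    stateAt_zero]

lemma sum_transCount (x : Fin n → A) : ∑ s, ∑ a, transCount k n s0 s a x = n := by
  simp_rw [sum_transCount_out]
  rw [Finset.sum_comm]
  simp

/-- The transition counts off a de Bruijn cycle determine all transition counts. -/
theorem transCount_eq_of_off_cycle {F : Equiv.Perm (Fin k → A)} {f : (Fin k → A) → A}
    (hf : ∀ s, F s = nextState s (f s)) (hF : ∀ s u, F.SameCycle s u) {x y : Fin n → A}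
    (hxy : ∀ s a, a ≠ f s → transCount k n s0 s a x = transCount k n s0 s a y)
    (s : Fin k → A) (a : A) : transCount k n s0 s a x = transCount k n s0 s a y := by
  set d : (Fin k → A) → ℤ := fun s =>
    (transCount k n s0 s (f s) x : ℤ) - transCount k n s0 s (f s) y with hd
  have hD : ∀ s a, (transCount k n s0 s a x : ℤ) - transCount k n s0 s a y =
      if a = f s then d s else 0 := by
    intro s a
    split_ifs with h
    · rw [h]
    · rw [hxy s a h, sub_self]
  have hout : ∀ u, (∑ a, (transCount k n s0 u a x : ℤ)) - ∑ a, (transCount k n s0 u a y : ℤ)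
      = d u := by
    intro u
    rw [← Finset.sum_sub_distrib]
    simp [hD]
  have hin : ∀ u, (∑ s, ∑ a, (if nextState s a = F u then (transCount k n s0 s a x : ℤ) else 0)) -
      ∑ s, ∑ a, (if nextState s a = F u then (transCount k n s0 s a y : ℤ) else 0) = d u := by
    intro u
    simp_rw [← Finset.sum_sub_distrib]
    have h : ∀ (s : Fin k → A) (a : A),
        ((if nextState s a = F u then (transCount k n s0 s a x : ℤ) else 0) -
        if nextState s a = F u then (transCount k n s0 s a y : ℤ) else 0) =
        if a = f s then (if s = u then d s else 0) else 0 := by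
      intro s a
      by_cases ha : a = f s
      · rw [ha, ← hf, if_pos rfl]
        simp only [F.injective.eq_iff]
        split_ifs <;> simp [hd]
      · rw [hxy s a ha, if_neg ha, sub_self]
    simp [h]
  have hflow : ∀ u, d (F u) + (if stateAt k n s0 x n = F u then 1 else 0) =
      d u + (if stateAt k n s0 y n = F u then 1 else 0) := by
    intro u
    have hx := congrArg (Nat.cast : ℕ → ℤ) (transCount_flow (s0 := s0) x (F u))
    have hy := congrArg (Nat.cast : ℕ → ℤ) (transCount_flow (s0 := s0) y (F u))
    push_cast at hx hy
    linarith [hout (F u), hin u]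
  have hsum : ∑ s, d s = 0 := by
    have hx := congrArg (Nat.cast : ℕ → ℤ) (sum_transCount (s0 := s0) x)
    have hy := congrArg (Nat.cast : ℕ → ℤ) (sum_transCount (s0 := s0) y)
    push_cast at hx hy
    rw [← Finset.sum_congr rfl fun u _ => hout u, Finset.sum_sub_distrib, hx, hy, sub_self]
  have h0 := hD s a
  rw [eq_zero_of_cyclic_flow hF hflow hsum s, ite_self] at h0
  omega

lemma seqProb_eq_prod (p : (Fin k → A) → A → ℝ) (x : Fin n → A) :
    seqProb k n s0 p x = ∏ s, ∏ a, p s a ^ transCount k n s0 s a x := by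
  simp_rw [transCount, ← Finset.prod_const, Finset.prod_filter, ite_and]
  rw [Finset.prod_congr rfl fun s _ => Finset.prod_comm, Finset.prod_comm]
  refine Finset.prod_congr rfl fun t _ => ?_
  rw [Finset.prod_eq_single (ctx k n s0 x t), Finset.prod_eq_single (x t)]
  · simp
  · intro b _ hb
    simp [hb.symm]
  · simp
  · intro b _ hb
    simp [hb.symm]
  · simp

lemma mem_typeClass {x y : Fin n → A} :
    y ∈ typeClass k n s0 x ↔ ∀ s a, transCount k n s0 s a y = transCount k n s0 s a x := by
  simp [typeClass]

lemma typeClass_eq_of_mem {x y : Fin n → A} (h : y ∈ typeClass k n s0 x) :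
    typeClass k n s0 y = typeClass k n s0 x := by
  ext z
  simp only [mem_typeClass] at h ⊢
  simp [h]

lemma self_mem_typeClass (x : Fin n → A) : x ∈ typeClass k n s0 x :=
  mem_typeClass.2 fun _ _ => rfl

lemma seqProb_eq_of_mem_typeClass (p : (Fin k → A) → A → ℝ) {x y : Fin n → A}
    (h : y ∈ typeClass k n s0 x) : seqProb k n s0 p y = seqProb k n s0 p x := by
  simp_rw [seqProb_eq_prod, mem_typeClass.1 h]

end Types

section Independence

open MvPolynomial in
lemma sum_fiber_eq_zero_of_sum_monomial_mul {σ ι : Type*} [Finite σ] [Fintype ι]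
    [DecidableEq (σ →₀ ℕ)]
    {N : ι → σ →₀ ℕ} {G : ι → MvPolynomial σ ℝ} {c : ι → ℝ}
    (hG : ∀ i, coeff 0 (G i) = 1) (hNG : ∀ i j, N i = N j → G i = G j)
    (h : ∑ i, C (c i) * (monomial (N i) 1 * G i) = 0) (m : σ →₀ ℕ) :
    ∑ i with N i = m, c i = 0 := by
  induction m using WellFoundedLT.induction with
  | ind m ih =>
    have hm := congrArg (coeff m) h
    simp only [coeff_sum, coeff_C_mul, coeff_monomial_mul', one_mul, coeff_zero] at hm
    rw [← Finset.sum_fiberwise_of_maps_to (t := insert m (univ.image N)) (g := N)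
      (fun i _ => by simp), Finset.sum_eq_single m] at hm
    · rw [← hm]
      refine Finset.sum_congr rfl fun i hi => ?_
      rw [(Finset.mem_filter.1 hi).2, if_pos le_rfl, tsub_self, hG, mul_one]
    · intro m' _ hne
      by_cases hle : m' ≤ m
      · rcases (univ.filter fun i => N i = m').eq_empty_or_nonempty with he | ⟨j, hj⟩
        · rw [he, Finset.sum_empty]
        · have hsum := ih m' (lt_of_le_of_ne hle hne)
          rw [← zero_mul (coeff (m - m') (G j)), ← hsum, Finset.sum_mul]
          refine Finset.sum_congr rfl fun i hi => ?_
          have hi' := (Finset.mem_filter.1 hi).2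
          rw [hi', if_pos hle, hNG i j (hi'.trans (Finset.mem_filter.1 hj).2.symm)]
      · refine Finset.sum_eq_zero fun i hi => ?_
        rw [(Finset.mem_filter.1 hi).2, if_neg hle, mul_zero]
    · simp

variable {A : Type*} [Fintype A] [DecidableEq A] [Inhabited A] {k n : ℕ} {s0 : Fin k → A}

/-- The generic kernel: free parameters off the edges `(s, f s)`. -/
noncomputable def genericKernel (f : (Fin k → A) → A) (s : Fin k → A) (a : A) :
    MvPolynomial ((Fin k → A) × A) ℝ :=
  if a = f s then 1 - ∑ b ∈ univ.erase (f s), MvPolynomial.X (s, b) else MvPolynomial.X (s, a)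

lemma isMarkov_eval_genericKernel (f : (Fin k → A) → A) {u : (Fin k → A) × A → ℝ}
    (h0 : ∀ q, 0 < u q) (h1 : ∀ q, u q < 1 / Fintype.card A) :
    IsMarkov k fun s a => MvPolynomial.eval u (genericKernel f s a) := by
  have hpos : (0 : ℝ) < Fintype.card A := by exact_mod_cast Fintype.card_pos
  refine ⟨fun s a => ?_, fun s => ?_⟩
  · beta_reduce
    unfold genericKernel
    split_ifs
    · simp only [map_sub, map_one, map_sum, MvPolynomial.eval_X, sub_pos]
      calc ∑ b ∈ univ.erase (f s), u (s, b) < ∑ b, u (s, b) :=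
            Finset.sum_lt_sum_of_subset (Finset.erase_subset _ _) (Finset.mem_univ (f s))
              (Finset.notMem_erase _ _) (h0 _) fun _ _ _ => (h0 _).le
        _ ≤ ∑ _b : A, (1 / Fintype.card A : ℝ) := Finset.sum_le_sum fun b _ => (h1 _).le
        _ = 1 := by simp [hpos.ne']
    · simpa using h0 _
  · rw [← Finset.add_sum_erase _ _ (Finset.mem_univ (f s))]
    have h : ∀ a ∈ univ.erase (f s), MvPolynomial.eval u (genericKernel f s a) = u (s, a) :=
      fun a ha => by simp [genericKernel, Finset.ne_of_mem_erase ha]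
    rw [Finset.sum_congr rfl h]
    simp [genericKernel]

open MvPolynomial in
/-- Type-class probabilities are linearly independent as functions of the Markov kernel. -/
theorem sum_typeClass_eq_zero {c : (Fin n → A) → ℝ}
    (h : ∀ p, IsMarkov k p → ∑ x, c x * seqProb k n s0 p x = 0) (x0 : Fin n → A) :
    ∑ x ∈ typeClass k n s0 x0, c x = 0 := by
  classical
  obtain ⟨F, hF, hcyc⟩ := exists_deBruijn_cycle (A := A) (k := k)
  choose f hf using hF
  let N : (Fin n → A) → ((Fin k → A) × A) →₀ ℕ := fun x =>
    Finsupp.equivFunOnFinite.symm fun q =>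
      if q.2 = f q.1 then 0 else transCount k n s0 q.1 q.2 x
  let G : (Fin n → A) → MvPolynomial ((Fin k → A) × A) ℝ := fun x =>
    ∏ s, genericKernel f s (f s) ^ transCount k n s0 s (f s) x
  have hN : ∀ x y, N x = N y ↔ x ∈ typeClass k n s0 y := by
    intro x y
    rw [mem_typeClass]
    constructor
    · intro hxy
      refine transCount_eq_of_off_cycle hf hcyc fun s a ha => ?_
      simpa [N, ha] using DFunLike.congr_fun hxy (s, a)
    · intro hxy
      ext q
      simp [N, hxy]
  have hG : ∀ x, coeff 0 (G x) = 1 := by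
    intro x
    rw [← constantCoeff_eq, map_prod]
    refine Finset.prod_eq_one fun s _ => ?_
    simp [genericKernel]
  have hNG : ∀ x y, N x = N y → G x = G y := by
    intro x y hxy
    have := mem_typeClass.1 ((hN x y).1 hxy)
    simp [G, this]
  have hprod : ∀ x, monomial (N x) 1 * G x =
      ∏ s, ∏ a, genericKernel f s a ^ transCount k n s0 s a x := by
    intro x
    rw [monomial_eq, C_1, one_mul, Finsupp.prod_fintype _ _ (fun _ => pow_zero _),
      Fintype.prod_prod_type, ← Finset.prod_mul_distrib]
    refine Finset.prod_congr rfl fun s _ => ?_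
    rw [← Finset.prod_erase_mul _ _ (Finset.mem_univ (f s)),
      ← Finset.prod_erase_mul univ (fun a => genericKernel f s a ^ _) (Finset.mem_univ (f s))]
    congr 1
    simp only [N, Finsupp.equivFunOnFinite_symm_apply_apply, if_pos, pow_zero, mul_one]
    refine Finset.prod_congr rfl fun a ha => ?_
    simp [genericKernel, Finset.ne_of_mem_erase ha]
  have hpos : (0 : ℝ) < 1 / Fintype.card A := by
    have : (0 : ℝ) < Fintype.card A := by exact_mod_cast Fintype.card_pos
    positivity
  have hzero : ∑ x, C (c x) * (monomial (N x) 1 * G x) = 0 := by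
    refine funext_set (fun _ => Set.Ioo (0 : ℝ) (1 / Fintype.card A))
      (fun _ => Set.Ioo_infinite hpos) fun u hu => ?_
    have hM := isMarkov_eval_genericKernel f (fun q => (hu q trivial).1) fun q => (hu q trivial).2
    rw [map_zero, ← h _ hM, map_sum]
    refine Finset.sum_congr rfl fun x _ => ?_
    rw [hprod, seqProb_eq_prod]
    simp
  have := sum_fiber_eq_zero_of_sum_monomial_mul hG hNG hzero (N x0)
  rw [← this]
  refine Finset.sum_congr ?_ fun _ _ => rfl
  ext x
  simp [hN]

end Independence

section Greedy

variable {pp : ℕ}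

lemma gmax_spec {r j : ℕ} (h : pp ^ j ≤ r) :
    (∃ i, gmax {m : ℕ | ∃ i : ℕ, m = pp ^ i} r = pp ^ i) ∧
      gmax {m : ℕ | ∃ i : ℕ, m = pp ^ i} r ≤ r ∧
      pp ^ j ≤ gmax {m : ℕ | ∃ i : ℕ, m = pp ^ i} r := by
  classical
  unfold gmax
  exact ⟨Nat.findGreatest_spec (P := (· ∈ {m : ℕ | ∃ i : ℕ, m = pp ^ i})) h ⟨j, rfl⟩,
    Nat.findGreatest_le _, Nat.le_findGreatest h ⟨j, rfl⟩⟩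

lemma pow_le_e2 (hpp : 2 ≤ pp) (j : ℕ) {r idx : ℕ} (h : idx < r / pp ^ j * pp ^ j) :
    pp ^ j ≤ (e2 {m : ℕ | ∃ i : ℕ, m = pp ^ i} r idx).1 := by
  induction idx using Nat.strong_induction_on generalizing r with
  | _ idx ih =>
    have hj : 0 < pp ^ j := pow_pos (by omega) j
    have hr : pp ^ j ≤ r := by
      by_contra hr
      rw [Nat.div_eq_of_lt (not_le.1 hr)] at h
      omega
    obtain ⟨⟨i, hi⟩, hle, hge⟩ := gmax_spec hr
    rw [e2]
    split_ifs with hc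
    · refine ih _ (by omega) ?_
      obtain ⟨q, hq⟩ : pp ^ j ∣ gmax {m : ℕ | ∃ i : ℕ, m = pp ^ i} r := by
        rw [hi]
        exact pow_dvd_pow _ ((Nat.pow_le_pow_iff_right (by omega)).1 (hi ▸ hge))
      rw [hq, Nat.sub_mul_div, Nat.sub_mul, mul_comm q]
      rw [hq] at hc
      omega
    · exact hge

lemma natLog_eq_sum (hpp : 2 ≤ pp) {m L : ℕ} (hm : m ≠ 0) (hL : Nat.log pp m ≤ L) :
    Nat.log pp m = ∑ j ∈ Icc 1 L, if pp ^ j ≤ m then 1 else 0 := by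
  have : (Icc 1 L).filter (fun j => pp ^ j ≤ m) = Icc 1 (Nat.log pp m) := by
    ext j
    simp only [Finset.mem_filter, Finset.mem_Icc, ← Nat.le_log_iff_pow_le (by omega : 1 < pp) hm]
    omega
  rw [← Finset.card_filter, this, Nat.card_Icc, Nat.add_sub_cancel]

lemma sum_le_natLog (hpp : 2 ≤ pp) (m L : ℕ) :
    ∑ j ∈ Icc 1 L, (if pp ^ j ≤ m then 1 else 0) ≤ Nat.log pp m := by
  rw [← Finset.card_filter]
  calc _ ≤ (Icc 1 (Nat.log pp m)).card := Finset.card_le_card fun j hj => by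
        simp only [Finset.mem_filter, Finset.mem_Icc] at hj ⊢
        exact ⟨hj.1.1, Nat.le_log_of_pow_le (by omega) hj.2⟩
    _ = _ := by simp

lemma natLog_mul_logb_le (hpp : 2 ≤ pp) (m : ℕ) :
    (Nat.log pp m : ℝ) * Real.logb 2 pp ≤ Real.logb 2 m := by
  rcases Nat.eq_zero_or_pos m with rfl | hm
  · simp
  · rw [← Real.logb_pow]
    have : (0 : ℝ) < pp := by exact_mod_cast (by omega : 0 < pp)
    refine Real.logb_le_logb_of_le (by norm_num) (by positivity) ?_
    exact_mod_cast Nat.pow_log_le_self pp hm.ne'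

variable {ι : Type*} {T : Finset ι}

lemma dvd_card_le_of_dvd_card_fiber {M : ι → ℕ} (hM : ∀ x, ∃ i, M x = pp ^ i) (hpp : 2 ≤ pp)
    (hdvd : ∀ i, pp ^ i ∣ (T.filter fun x => M x = pp ^ i).card) (j : ℕ) :
    pp ^ j ∣ (T.filter fun x => pp ^ j ≤ M x).card := by
  classical
  rw [Finset.card_eq_sum_card_image M]
  refine Finset.dvd_sum fun m hm => ?_
  obtain ⟨x, hx, rfl⟩ := Finset.mem_image.1 hm
  obtain ⟨i, hi⟩ := hM x
  have hx2 := (Finset.mem_filter.1 hx).2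
  have hji : j ≤ i := (Nat.pow_le_pow_iff_right (by omega)).1 (hi ▸ hx2)
  have : (T.filter fun y => pp ^ j ≤ M y).filter (fun y => M y = M x) =
      T.filter fun y => M y = pp ^ i := by
    rw [Finset.filter_filter, hi]
    refine Finset.filter_congr fun y _ => ⟨fun h => h.2, fun h => ⟨?_, h⟩⟩
    rw [h, ← hi]
    exact hx2
  rw [this]
  exact (pow_dvd_pow pp hji).trans (hdvd i)

lemma card_filter_pow_le_e2 (hpp : 2 ≤ pp) {enum : ι → ℕ} (hlt : ∀ x ∈ T, enum x < T.card)
    (hinj : Set.InjOn enum T) (j : ℕ) :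
    T.card / pp ^ j * pp ^ j ≤
      (T.filter fun x => pp ^ j ≤ (e2 {m : ℕ | ∃ i : ℕ, m = pp ^ i} T.card (enum x)).1).card := by
  classical
  have himg : T.image enum = range T.card := by
    refine Finset.eq_of_subset_of_card_le ?_ ?_
    · intro m hm
      obtain ⟨x, hx, rfl⟩ := Finset.mem_image.1 hm
      exact Finset.mem_range.2 (hlt x hx)
    · rw [Finset.card_image_of_injOn hinj, Finset.card_range]
  calc T.card / pp ^ j * pp ^ j = (range (T.card / pp ^ j * pp ^ j)).card := by simp
    _ ≤ ((T.filter fun x => enum x < T.card / pp ^ j * pp ^ j).image enum).card := by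
        refine Finset.card_le_card fun m hm => ?_
        have hm' := Finset.mem_range.1 hm
        have : m ∈ T.image enum := by
          rw [himg, Finset.mem_range]
          exact hm'.trans_le (Nat.div_mul_le_self _ _)
        obtain ⟨x, hx, rfl⟩ := Finset.mem_image.1 this
        exact Finset.mem_image_of_mem _ (Finset.mem_filter.2 ⟨hx, hm'⟩)
    _ ≤ (T.filter fun x => enum x < T.card / pp ^ j * pp ^ j).card := Finset.card_image_le
    _ ≤ _ := Finset.card_le_card
        (Finset.monotone_filter_right _ fun _ _ hx => pow_le_e2 hpp j hx)

/-- The greedy decomposition maximizes the total log-size among all partitions of `T` whose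
classes of size-label `pp ^ i` have cardinality divisible by `pp ^ i`. -/
theorem sum_logb_le_sum_logb_e2 (hpp : 2 ≤ pp) {M enum : ι → ℕ} (hM : ∀ x, ∃ i, M x = pp ^ i)
    (hdvd : ∀ i, pp ^ i ∣ (T.filter fun x => M x = pp ^ i).card)
    (hlt : ∀ x ∈ T, enum x < T.card) (hinj : Set.InjOn enum T) :
    ∑ x ∈ T, Real.logb 2 (M x) ≤
      ∑ x ∈ T, Real.logb 2 (e2 {m : ℕ | ∃ i : ℕ, m = pp ^ i} T.card (enum x)).1 := by
  set E : ι → ℕ := fun x => (e2 {m : ℕ | ∃ i : ℕ, m = pp ^ i} T.card (enum x)).1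
  have hlog : ∀ x, Real.logb 2 (M x) = Nat.log pp (M x) * Real.logb 2 pp := by
    intro x
    obtain ⟨i, hi⟩ := hM x
    rw [hi, Nat.log_pow (by omega), Nat.cast_pow, Real.logb_pow]
  have hpos : 0 ≤ Real.logb 2 pp :=
    Real.logb_nonneg (by norm_num) (by exact_mod_cast (by omega : 1 ≤ pp))
  have hcount : ∀ j, (T.filter fun x => pp ^ j ≤ M x).card ≤
      (T.filter fun x => pp ^ j ≤ E x).card := by
    intro j
    obtain ⟨q, hq⟩ := dvd_card_le_of_dvd_card_fiber hM hpp hdvd j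
    refine le_trans ?_ (card_filter_pow_le_e2 hpp hlt hinj j)
    have hle : (T.filter fun x => pp ^ j ≤ M x).card ≤ T.card := Finset.card_filter_le _ _
    rw [hq] at hle ⊢
    rw [mul_comm]
    refine Nat.mul_le_mul_right _ ((Nat.le_div_iff_mul_le (pow_pos (by omega) j)).2 ?_)
    rwa [mul_comm]
  have hnat : ∑ x ∈ T, Nat.log pp (M x) ≤ ∑ x ∈ T, Nat.log pp (E x) := by
    set L := T.sup fun x => Nat.log pp (M x)
    calc ∑ x ∈ T, Nat.log pp (M x)
        = ∑ x ∈ T, ∑ j ∈ Icc 1 L, (if pp ^ j ≤ M x then 1 else 0) := by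
          refine Finset.sum_congr rfl fun x hx => natLog_eq_sum hpp ?_
            (Finset.le_sup (f := fun x => Nat.log pp (M x)) hx)
          obtain ⟨i, hi⟩ := hM x
          rw [hi]
          exact (pow_pos (by omega) i).ne'
      _ = ∑ j ∈ Icc 1 L, (T.filter fun x => pp ^ j ≤ M x).card := by
          rw [Finset.sum_comm]
          simp_rw [Finset.card_filter]
      _ ≤ ∑ j ∈ Icc 1 L, (T.filter fun x => pp ^ j ≤ E x).card :=
          Finset.sum_le_sum fun j _ => hcount j
      _ = ∑ x ∈ T, ∑ j ∈ Icc 1 L, (if pp ^ j ≤ E x then 1 else 0) := by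
          simp_rw [Finset.card_filter]
          rw [Finset.sum_comm]
      _ ≤ ∑ x ∈ T, Nat.log pp (E x) := Finset.sum_le_sum fun x _ => sum_le_natLog hpp _ _
  calc ∑ x ∈ T, Real.logb 2 (M x)
      = ((∑ x ∈ T, Nat.log pp (M x) : ℕ) : ℝ) * Real.logb 2 pp := by
        rw [Nat.cast_sum, Finset.sum_mul]
        exact Finset.sum_congr rfl fun x _ => hlog x
    _ ≤ ((∑ x ∈ T, Nat.log pp (E x) : ℕ) : ℝ) * Real.logb 2 pp :=
        mul_le_mul_of_nonneg_right (by exact_mod_cast hnat) hpos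
    _ ≤ ∑ x ∈ T, Real.logb 2 (E x) := by
        rw [Nat.cast_sum, Finset.sum_mul]
        exact Finset.sum_le_sum fun x _ => natLog_mul_logb_le hpp _

end Greedy

/-- A universal FVR splits every type class into label classes of divisible cardinality. -/
theorem dvd_card_typeClass_of_universal {A : Type*} [Fintype A] [DecidableEq A] [Inhabited A]
    {k n : ℕ} {s0 : Fin k → A} {S : Set ℕ} {Mf Rf : (Fin n → A) → ℕ}
    (huniv : ∀ p : (Fin k → A) → A → ℝ, IsMarkov k p → PerfectFVR k n s0 p S Mf Rf)
    {m : ℕ} (hm : m ∈ S) (hm0 : 0 < m) (x0 : Fin n → A) :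
    m ∣ ((typeClass k n s0 x0).filter fun x => Mf x = m).card := by
  rcases (univ.filter fun x => Mf x = m).eq_empty_or_nonempty with he | hne
  · have : (typeClass k n s0 x0).filter (fun x => Mf x = m) = ∅ :=
      Finset.subset_empty.1 (he ▸ Finset.filter_subset_filter _ (Finset.subset_univ _))
    simp [this]
  · have h := sum_typeClass_eq_zero (k := k) (s0 := s0)
      (c := fun x => (if Mf x = m ∧ Rf x = 0 then 1 else 0) - (if Mf x = m then 1 else 0) / (m : ℝ))
      (fun p hp => by
        have hpos : 0 < ∑ x ∈ univ.filter (fun x : Fin n → A => Mf x = m), seqProb k n s0 p x :=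
          Finset.sum_pos (fun x _ => Finset.prod_pos fun t _ => hp.1 _ _) hne
        have := huniv p hp m hm hpos 0 hm0
        rw [Finset.sum_filter, Finset.sum_filter, Finset.sum_div] at this
        rw [← sub_eq_zero, ← Finset.sum_sub_distrib] at this
        refine Eq.trans (Finset.sum_congr rfl fun x _ => ?_) this
        rw [sub_mul, div_mul_eq_mul_div, ite_mul, ite_mul, one_mul, zero_mul]) x0
    rw [Finset.sum_sub_distrib, ← Finset.sum_div, Finset.sum_boole, Finset.sum_boole,
      sub_eq_zero, eq_div_iff (by exact_mod_cast hm0.ne')] at h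
    exact ⟨_, by rw [mul_comm]; exact_mod_cast h.symm⟩

/-- For the target set `S = {p^i : i ≥ 0}` (`p ≥ 2`), Procedure E2
is pointwise optimal: every universal FVR with the same target set has expected
output length at most that of `F**`. -/
theorem elias_e2_pointwise_optimal_for_powers {A : Type*} [Fintype A] [DecidableEq A]
    [Inhabited A] (hA : 2 ≤ Fintype.card A) (k n : ℕ) (s0 : Fin k → A)
    (pp : ℕ) (hpp : 2 ≤ pp)
    (enum : (Fin n → A) → ℕ)
    (henum1 : ∀ x, enum x < (typeClass k n s0 x).card)
    (henum2 : ∀ x y, y ∈ typeClass k n s0 x → enum y = enum x → y = x)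
    (Mf Rf : (Fin n → A) → ℕ)
    (hMS : ∀ x, Mf x ∈ {m : ℕ | ∃ i : ℕ, m = pp ^ i})
    (hRM : ∀ x, Rf x < Mf x)
    (huniv : ∀ p : (Fin k → A) → A → ℝ, IsMarkov k p →
      PerfectFVR k n s0 p {m : ℕ | ∃ i : ℕ, m = pp ^ i} Mf Rf) :
    ∀ p : (Fin k → A) → A → ℝ, IsMarkov k p →
      (∑ x : Fin n → A, seqProb k n s0 p x * Real.logb 2 (Mf x))
        ≤ ∑ x : Fin n → A,
            seqProb k n s0 p x *
              Real.logb 2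
                ((e2 {m : ℕ | ∃ i : ℕ, m = pp ^ i}
                    ((typeClass k n s0 x).card) (enum x)).1) := by
  intro p hp
  rw [← Finset.sum_fiberwise_of_maps_to (t := univ.image (typeClass k n s0))
      (g := typeClass k n s0) (fun x _ => Finset.mem_image_of_mem _ (Finset.mem_univ x)),
    ← Finset.sum_fiberwise_of_maps_to (t := univ.image (typeClass k n s0))
      (g := typeClass k n s0) (fun x _ => Finset.mem_image_of_mem _ (Finset.mem_univ x))]
  refine Finset.sum_le_sum fun T hT => ?_
  obtain ⟨x0, -, rfl⟩ := Finset.mem_image.1 hT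
  have hfib : univ.filter (fun x => typeClass k n s0 x = typeClass k n s0 x0) =
      typeClass k n s0 x0 := by
    ext x
    simp only [Finset.mem_filter, Finset.mem_univ, true_and]
    exact ⟨fun h => h ▸ self_mem_typeClass x, typeClass_eq_of_mem⟩
  have hfactor : ∀ g : (Fin n → A) → ℝ, ∑ x ∈ typeClass k n s0 x0, seqProb k n s0 p x * g x =
      seqProb k n s0 p x0 * ∑ x ∈ typeClass k n s0 x0, g x := by
    intro g
    rw [Finset.mul_sum]
    exact Finset.sum_congr rfl fun x hx => by rw [seqProb_eq_of_mem_typeClass p hx]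
  rw [hfib, hfactor, hfactor]
  refine mul_le_mul_of_nonneg_left ?_ (Finset.prod_pos fun t _ => hp.1 _ _).le
  refine (sum_logb_le_sum_logb_e2 hpp (enum := enum) hMS
    (fun i => dvd_card_typeClass_of_universal huniv ⟨i, rfl⟩ (pow_pos (by omega) i) x0)
    (fun x hx => ?_) fun x hx y hy hxy => ?_).trans_eq
    (Finset.sum_congr rfl fun x hx => by rw [typeClass_eq_of_mem hx])
  · rw [← typeClass_eq_of_mem hx]
    exact henum1 x
  · refine henum2 y x ?_ hxy
    rw [typeClass_eq_of_mem hy]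
    exact hx
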